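/- Let A be a real m×d matrix with eigendecomposition AᵀA = V Diag(s₁², …, s_d²) Vᵀ, where V is a d×d orthogonal matrix and s_i ≥ 0. Let x₀ ∈ ℝ^d be fixed, σ_y > 0, and 0 < ν ≤ σ'². Let w, e, ε be independent standard Gaussian random vectors on ℝ^m, ℝ^d, ℝ^d respectively. Define y = A x₀ + σ_y w, x̄ = x₀ - √ν e, x̂ = (AᵀA + (σ_y²/ν)·I)⁻¹ (Aᵀy + (σ_y²/ν)·x̄), λ_i = σ'² - (s_i²/σ_y² + 1/ν)⁻¹ for i = 1, …, d, and c = V Diag(√λ₁, …, √λ_d) ε. Then the random vector r = x̂ + c satisfies: r - x₀ is a centered Gaussian random vector on ℝ^d with covariance σ'²·I (equivalently, the law of r is the Gaussian measure N(x₀, σ'²·I)). -/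

import Mathlib

open MeasureTheory ProbabilityTheory Matrix

/-- The law of a standard Gaussian random vector on `ℝ^n`: the product of `n`
standard Gaussian measures on `ℝ`. -/
noncomputable def stdGaussian (n : ℕ) : Measure (Fin n → ℝ) :=
  Measure.pi fun _ => gaussianReal 0 1

lemma int_exp_pi (n : ℕ) (v : NNReal) (t : Fin n → ℝ) :
    ∫ x, Complex.exp ((t ⬝ᵥ x : ℝ) * Complex.I) ∂(Measure.pi fun _ : Fin n => gaussianReal 0 v)
      = Complex.exp (-((v * (t ⬝ᵥ t) / 2 : ℝ) : ℂ)) := by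
  have h : ∀ x : Fin n → ℝ, Complex.exp ((t ⬝ᵥ x : ℝ) * Complex.I)
      = ∏ i, Complex.exp (t i * x i * Complex.I) := by
    intro x
    rw [← Complex.exp_sum, ← Finset.sum_mul]
    simp [dotProduct]
  simp_rw [h]
  rw [integral_fintype_prod_eq_prod (fun i (x : ℝ) => Complex.exp (t i * x * Complex.I))]
  simp_rw [← charFun_apply_real, charFun_gaussianReal]
  rw [← Complex.exp_sum]
  congr 1
  simp only [dotProduct, Finset.mul_sum, Finset.sum_div]
  push_cast
  rw [← Finset.sum_neg_distrib]
  exact Finset.sum_congr rfl fun i _ => by ring_nf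

lemma map_lin_gauss (m d : ℕ) (v : NNReal) (P : Matrix (Fin d) (Fin m) ℝ)
    (Q R : Matrix (Fin d) (Fin d) ℝ)
    (h : P * Pᵀ + Q * Qᵀ + R * Rᵀ = (v : ℝ) • 1) :
    Measure.map (fun ω : (Fin m → ℝ) × (Fin d → ℝ) × (Fin d → ℝ) =>
        P *ᵥ ω.1 + (Q *ᵥ ω.2.1 + R *ᵥ ω.2.2))
      ((stdGaussian m).prod ((stdGaussian d).prod (stdGaussian d)))
      = Measure.pi (fun _ : Fin d => gaussianReal 0 v) := by
  have hp : ∀ n, IsProbabilityMeasure (_root_.stdGaussian n) := fun n => by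
    unfold _root_.stdGaussian; infer_instance
  have hc : Continuous (fun ω : (Fin m → ℝ) × (Fin d → ℝ) × (Fin d → ℝ) =>
        P *ᵥ ω.1 + (Q *ᵥ ω.2.1 + R *ᵥ ω.2.2)) := by fun_prop
  have : IsProbabilityMeasure (Measure.map (fun ω : (Fin m → ℝ) × (Fin d → ℝ) × (Fin d → ℝ) =>
        P *ᵥ ω.1 + (Q *ᵥ ω.2.1 + R *ᵥ ω.2.2))
      ((_root_.stdGaussian m).prod ((_root_.stdGaussian d).prod (_root_.stdGaussian d)))) :=
    Measure.isProbabilityMeasure_map hc.aemeasurable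
  refine Measure.ext_of_charFunDual ?_
  ext L
  obtain ⟨t, ht⟩ : ∃ t : Fin d → ℝ, ∀ x, L x = t ⬝ᵥ x := by
    refine ⟨fun i => L (Pi.single i 1), fun x => ?_⟩
    conv_lhs => rw [pi_eq_sum_univ' x]
    simp [dotProduct, mul_comm, Pi.single_apply, Pi.single, Function.update]
  simp_rw [charFunDual_apply, ht]
  rw [int_exp_pi, integral_map hc.aemeasurable (by fun_prop)]
  have hi : ∀ ω : (Fin m → ℝ) × (Fin d → ℝ) × (Fin d → ℝ),
      Complex.exp ((t ⬝ᵥ (P *ᵥ ω.1 + (Q *ᵥ ω.2.1 + R *ᵥ ω.2.2)) : ℝ) * Complex.I)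
      = Complex.exp (((Pᵀ *ᵥ t) ⬝ᵥ ω.1 : ℝ) * Complex.I) *
        (Complex.exp (((Qᵀ *ᵥ t) ⬝ᵥ ω.2.1 : ℝ) * Complex.I) *
        Complex.exp (((Rᵀ *ᵥ t) ⬝ᵥ ω.2.2 : ℝ) * Complex.I)) := by
    intro ω
    simp only [dotProduct_add, dotProduct_mulVec, mulVec_transpose]
    rw [← Complex.exp_add, ← Complex.exp_add]
    push_cast
    ring_nf
  simp_rw [hi]
  rw [integral_prod_mul (fun x : Fin m → ℝ => Complex.exp (((Pᵀ *ᵥ t) ⬝ᵥ x : ℝ) * Complex.I))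
    (fun z : (Fin d → ℝ) × (Fin d → ℝ) => Complex.exp (((Qᵀ *ᵥ t) ⬝ᵥ z.1 : ℝ) * Complex.I) *
        Complex.exp (((Rᵀ *ᵥ t) ⬝ᵥ z.2 : ℝ) * Complex.I)),
    integral_prod_mul (fun x : Fin d → ℝ => Complex.exp (((Qᵀ *ᵥ t) ⬝ᵥ x : ℝ) * Complex.I))
    (fun x : Fin d → ℝ => Complex.exp (((Rᵀ *ᵥ t) ⬝ᵥ x : ℝ) * Complex.I))]
  simp only [_root_.stdGaussian, int_exp_pi]
  rw [← Complex.exp_add, ← Complex.exp_add]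
  have key : (Pᵀ *ᵥ t) ⬝ᵥ (Pᵀ *ᵥ t) + (Qᵀ *ᵥ t) ⬝ᵥ (Qᵀ *ᵥ t) + (Rᵀ *ᵥ t) ⬝ᵥ (Rᵀ *ᵥ t)
      = v * (t ⬝ᵥ t) := by
    have := congrArg (fun M => t ⬝ᵥ (M *ᵥ t)) h
    simp only [add_mulVec, dotProduct_add, ← mulVec_mulVec, smul_mulVec, one_mulVec,
      dotProduct_smul, smul_eq_mul] at this
    rw [← this]
    simp only [dotProduct_mulVec t, ← mulVec_transpose]
  congr 1
  rw [← key]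
  push_cast
  ring

/-- One FIRE iteration maps white-Gaussian-error inputs to white-Gaussian-error outputs:
with `y = A x₀ + σ_y w`, `x̄ = x₀ - √ν e`, MMSE estimate `x̂`, and colored renoising
`c = V Diag(√λ) ε` where `λᵢ = σ'² - (sᵢ²/σ_y² + 1/ν)⁻¹`, the renoised `r = x̂ + c`
satisfies `r - x₀ ~ N(0, σ'² I)`, i.e. the law of `r - x₀` is the product of `d`
centered Gaussians of variance `σ'²`. -/
theorem fire_renoising_white_gaussian
    (m d : ℕ) (A : Matrix (Fin m) (Fin d) ℝ)
    (V : Matrix (Fin d) (Fin d) ℝ) (s : Fin d → ℝ)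
    (hV : Vᵀ * V = 1) (hs : ∀ i, 0 ≤ s i)
    (hAA : Aᵀ * A = V * Matrix.diagonal (fun i => s i ^ 2) * Vᵀ)
    (x0 : Fin d → ℝ) (σy ν σ' : ℝ) (hσy : 0 < σy) (hν : 0 < ν) (hνσ : ν ≤ σ' ^ 2)
    (lam : Fin d → ℝ) (hlam : ∀ i, lam i = σ' ^ 2 - (s i ^ 2 / σy ^ 2 + 1 / ν)⁻¹)
    (r : (Fin m → ℝ) × (Fin d → ℝ) × (Fin d → ℝ) → (Fin d → ℝ))
    (hr : ∀ ω : (Fin m → ℝ) × (Fin d → ℝ) × (Fin d → ℝ),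
      r ω = (Aᵀ * A + (σy ^ 2 / ν) • (1 : Matrix (Fin d) (Fin d) ℝ))⁻¹
          *ᵥ (Aᵀ *ᵥ (A *ᵥ x0 + σy • ω.1) + (σy ^ 2 / ν) • (x0 - Real.sqrt ν • ω.2.1))
        + V *ᵥ (fun i => Real.sqrt (lam i) * ω.2.2 i)) :
    Measure.map (fun ω => r ω - x0)
        ((stdGaussian m).prod ((stdGaussian d).prod (stdGaussian d)))
      = Measure.pi (fun _ : Fin d => gaussianReal 0 (Real.toNNReal (σ' ^ 2))) := by
  set κ : ℝ := σy ^ 2 / ν with hκ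
  have hκ0 : 0 < κ := by positivity
  have hV' : V * Vᵀ = 1 := mul_eq_one_comm.mp hV
  set D : Matrix (Fin d) (Fin d) ℝ := Matrix.diagonal (fun i => s i ^ 2 + κ) with hD
  set E : Matrix (Fin d) (Fin d) ℝ := Matrix.diagonal (fun i => (s i ^ 2 + κ)⁻¹) with hE
  have hpos : ∀ i, 0 < s i ^ 2 + κ := fun i => by positivity
  have hB : Aᵀ * A + κ • (1 : Matrix (Fin d) (Fin d) ℝ) = V * D * Vᵀ := by
    have : D = Matrix.diagonal (fun i => s i ^ 2) + κ • (1 : Matrix (Fin d) (Fin d) ℝ) := by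
      rw [hD, smul_one_eq_diagonal, diagonal_add]
    rw [this, hAA, mul_add, add_mul, Matrix.mul_smul, Matrix.mul_one, Matrix.smul_mul, hV']
  set B := Aᵀ * A + κ • (1 : Matrix (Fin d) (Fin d) ℝ) with hBdef
  have hDE : D * E = 1 := by
    rw [hD, hE, diagonal_mul_diagonal, ← diagonal_one]
    congr 1; ext i; exact mul_inv_cancel₀ (hpos i).ne'
  set M : Matrix (Fin d) (Fin d) ℝ := V * E * Vᵀ with hM
  have hBM : B * M = 1 := by
    rw [hB, hM]
    calc V * D * Vᵀ * (V * E * Vᵀ) = V * D * (Vᵀ * V) * E * Vᵀ := by simp only [Matrix.mul_assoc]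
      _ = V * (D * E) * Vᵀ := by rw [hV]; simp only [Matrix.mul_assoc, Matrix.one_mul]
      _ = 1 := by rw [hDE, Matrix.mul_one, hV']
  have hMB : M * B = 1 := mul_eq_one_comm.mp hBM
  have hBinv : B⁻¹ = M := inv_eq_right_inv hBM
  have hMt : Mᵀ = M := by
    rw [hM, hE]; simp [Matrix.transpose_mul, Matrix.mul_assoc]
  have hlam0 : ∀ i, 0 ≤ lam i := by
    intro i
    rw [hlam i]
    have h1 : (s i ^ 2 / σy ^ 2 + 1 / ν)⁻¹ ≤ (1 / ν)⁻¹ := by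
      apply inv_anti₀ (by positivity)
      have : 0 ≤ s i ^ 2 / σy ^ 2 := by positivity
      linarith
    rw [one_div, inv_inv] at h1
    rw [one_div] at *
    linarith
  have hlam1 : ∀ i, σy ^ 2 * (s i ^ 2 + κ)⁻¹ + lam i = σ' ^ 2 := by
    intro i
    rw [hlam i]
    have : (s i ^ 2 / σy ^ 2 + 1 / ν)⁻¹ = σy ^ 2 * (s i ^ 2 + κ)⁻¹ := by
      rw [← div_eq_mul_inv, ← inv_div]
      congr 1
      rw [hκ]; field_simp
    rw [this]; ring
  set S : Matrix (Fin d) (Fin d) ℝ := Matrix.diagonal (fun i => Real.sqrt (lam i)) with hS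
  have hfun : (fun ω => r ω - x0) = fun ω : (Fin m → ℝ) × (Fin d → ℝ) × (Fin d → ℝ) =>
      (σy • (M * Aᵀ)) *ᵥ ω.1 + ((-(κ * Real.sqrt ν) • M) *ᵥ ω.2.1 + (V * S) *ᵥ ω.2.2) := by
    funext ω
    have e1 : (fun i => Real.sqrt (lam i) * ω.2.2 i) = S *ᵥ ω.2.2 := by
      ext i; simp [hS, mulVec_diagonal]
    have e2 : M *ᵥ (Aᵀ *ᵥ (A *ᵥ x0)) + κ • (M *ᵥ x0) = x0 := by
      have := congrArg (fun N => N *ᵥ x0) hMB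
      simpa [hBdef, mul_add, add_mulVec, smul_mulVec, mulVec_mulVec] using this
    rw [hr ω, hBinv, e1]
    simp only [mulVec_add, mulVec_sub, mulVec_smul, smul_mulVec, ← mulVec_mulVec, smul_sub,
      smul_smul]
    rw [neg_smul, sub_eq_iff_eq_add]
    conv_rhs => rw [← e2]
    abel
  rw [hfun]
  apply map_lin_gauss
  rw [Real.coe_toNNReal _ (sq_nonneg _)]
  have p1 : (σy • (M * Aᵀ)) * (σy • (M * Aᵀ))ᵀ
      + (-(κ * Real.sqrt ν) • M) * (-(κ * Real.sqrt ν) • M)ᵀ = σy ^ 2 • M := by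
    have hk : (κ * Real.sqrt ν) * (κ * Real.sqrt ν) = σy ^ 2 * κ := by
      rw [mul_mul_mul_comm, Real.mul_self_sqrt hν.le, hκ]; field_simp
    simp only [transpose_smul, transpose_mul, transpose_transpose, hMt, Matrix.smul_mul, Matrix.mul_smul,
      smul_smul, neg_mul_neg, hk]
    calc _ = σy ^ 2 • (M * B * M) := by
          rw [hBdef]
          simp only [mul_add, add_mul, smul_add, Matrix.mul_assoc, Matrix.smul_mul, Matrix.mul_smul, smul_smul,
            Matrix.one_mul, sq]
      _ = _ := by rw [hMB, Matrix.one_mul]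
  have p2 : (V * S) * (V * S)ᵀ = V * Matrix.diagonal lam * Vᵀ := by
    have : S * S = Matrix.diagonal lam := by
      rw [hS, diagonal_mul_diagonal]
      congr 1; ext i; exact Real.mul_self_sqrt (hlam0 i)
    rw [← this, transpose_mul, hS, diagonal_transpose]
    simp only [Matrix.mul_assoc]
  rw [p1, p2, hM]
  have p3 : σy ^ 2 • E + Matrix.diagonal lam = σ' ^ 2 • (1 : Matrix (Fin d) (Fin d) ℝ) := by
    rw [smul_one_eq_diagonal, hE, ← diagonal_smul, diagonal_add]
    congr 1; ext i; exact hlam1 i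
  calc _ = V * (σy ^ 2 • E + Matrix.diagonal lam) * Vᵀ := by
        simp only [mul_add, add_mul, Matrix.mul_smul, Matrix.smul_mul]
    _ = _ := by rw [p3, Matrix.mul_smul, Matrix.smul_mul, Matrix.mul_one, hV']
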